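/- arXiv:2605.06031 — 8 statements merged into one kernel-verified Lean document; each statement's English description precedes it below -/
import Mathlib

section
/- Let α < β be real numbers and let f : ℝ → ℝ be continuously differentiable on [α, β] with f(α) = f(β) = 0 and ∫_α^β f(x) dx = 0. Then ∫_α^β (f(x))² dx ≤ ((β − α)²/(4π²)) · ∫_α^β (f'(x))² dx. -/
open MeasureTheory intervalIntegral

theorem ContinuousOn.memLp_two_restrict_Ioc {a b : ℝ} {g : ℝ → ℂ}
    (hg : ContinuousOn g (Set.Icc a b)) : MemLp g 2 (volume.restrict (Set.Ioc a b)) := by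
  have hm : AEStronglyMeasurable g (volume.restrict (Set.Ioc a b)) :=
    (hg.mono Set.Ioc_subset_Icc_self).aestronglyMeasurable measurableSet_Ioc
  rw [memLp_two_iff_integrable_sq_norm hm]
  exact ((hg.norm.pow 2).integrableOn_Icc).mono_set Set.Ioc_subset_Icc_self

/-- Periodic boundary values make each Fourier coefficient of nonzero frequency at most
`(b - a) / (2π)` times that of the derivative. -/
theorem norm_fourierCoeffOn_sq_le_of_hasDerivAt_Ioo {a b : ℝ} (hab : a < b) {g g' : ℝ → ℂ} {n : ℤ}
    (hn : n ≠ 0) (hg : ContinuousOn g (Set.uIcc a b))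
    (hgg' : ∀ x ∈ Set.Ioo (min a b) (max a b), HasDerivAt g (g' x) x)
    (hg' : IntervalIntegrable g' volume a b) (hper : g a = g b) :
    ‖fourierCoeffOn hab g n‖ ^ 2 ≤
      (b - a) ^ 2 / (4 * Real.pi ^ 2) * ‖fourierCoeffOn hab g' n‖ ^ 2 := by
  have hn1 : (1 : ℝ) ≤ (n : ℝ) ^ 2 := by
    exact_mod_cast Int.one_le_abs (pow_ne_zero 2 hn) |>.trans_eq (abs_of_nonneg (sq_nonneg n))
  have hnorm : ‖fourierCoeffOn hab g n‖ ^ 2 =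
      (b - a) ^ 2 / (4 * Real.pi ^ 2 * (n : ℝ) ^ 2) * ‖fourierCoeffOn hab g' n‖ ^ 2 := by
    rw [fourierCoeffOn_of_hasDerivAt_Ioo hab hn hg hgg' hg', hper, sub_self, mul_zero, zero_sub,
      ← Complex.ofReal_sub]
    simp only [norm_mul, norm_div, norm_neg, norm_one, Complex.norm_real, Complex.norm_I,
      Complex.norm_intCast, Complex.norm_ofNat, Real.norm_eq_abs, mul_pow, div_pow, sq_abs]
    ring
  rw [hnorm]
  gcongr (b - a) ^ 2 / ?_ * _
  exact le_mul_of_one_le_right (by positivity) hn1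

/-- Wirtinger's inequality with zero boundary values and zero mean, with the sharp
constant `(β - α)² / (4π²)`. -/
theorem wirtinger_inequality
    (α β : ℝ) (hαβ : α < β) (f f' : ℝ → ℝ)
    (hderiv : ∀ x ∈ Set.Icc α β, HasDerivWithinAt f (f' x) (Set.Icc α β) x)
    (hcont : ContinuousOn f' (Set.Icc α β))
    (hfα : f α = 0) (hfβ : f β = 0)
    (hmean : (∫ x in α..β, f x) = 0) :
    (∫ x in α..β, (f x) ^ 2) ≤
      (β - α) ^ 2 / (4 * Real.pi ^ 2) * ∫ x in α..β, (f' x) ^ 2 := by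
  have hf : ContinuousOn (fun x => (f x : ℂ)) (Set.Icc α β) :=
    Complex.continuous_ofReal.comp_continuousOn fun x hx => (hderiv x hx).continuousWithinAt
  have hf' : ContinuousOn (fun x => (f' x : ℂ)) (Set.Icc α β) :=
    Complex.continuous_ofReal.comp_continuousOn hcont
  have hzero : fourierCoeffOn hαβ (fun x => (f x : ℂ)) 0 = 0 := by
    simp [fourierCoeffOn_eq_integral, intervalIntegral.integral_ofReal, hmean]
  have hle := hasSum_le (fun n => ?_)
    (hasSum_sq_fourierCoeffOn hαβ hf.memLp_two_restrict_Ioc)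
    ((hasSum_sq_fourierCoeffOn hαβ hf'.memLp_two_restrict_Ioc).mul_left
      ((β - α) ^ 2 / (4 * Real.pi ^ 2)))
  · simp only [Complex.norm_real, Real.norm_eq_abs, sq_abs, smul_eq_mul] at hle
    rw [mul_left_comm] at hle
    exact le_of_mul_le_mul_left hle (inv_pos.2 (sub_pos.2 hαβ))
  · rcases eq_or_ne n 0 with rfl | hn
    · rw [hzero, norm_zero, zero_pow two_ne_zero]
      positivity
    · refine norm_fourierCoeffOn_sq_le_of_hasDerivAt_Ioo hαβ hn
        (by rwa [Set.uIcc_of_le hαβ.le]) (fun x hx => ?_)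
        (hf'.intervalIntegrable_of_Icc hαβ.le) (by simp [hfα, hfβ])
      rw [min_eq_left hαβ.le, max_eq_right hαβ.le] at hx
      exact ((hderiv x (Set.Ioo_subset_Icc_self hx)).hasDerivAt
        (Icc_mem_nhds hx.1 hx.2)).ofReal_comp
end

section
/- Let a < b be real numbers and let w : ℝ → ℝ be twice continuously differentiable on [a, b] with w(a) = w(b) = 0 and w'(a) = w'(b) = 0. Then ∫_a^b (w'(x))² dx ≤ ((b − a)²/(4π²)) · ∫_a^b (w''(x))² dx. -/
open MeasureTheory intervalIntegral

/-- A function continuous on a compact interval is in `L^p` on its half-open part. -/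
theorem memLp_restrict_Ioc_of_continuousOn_Icc {a b : ℝ} {f : ℝ → ℂ} (p : ENNReal)
    (hf : ContinuousOn f (Set.Icc a b)) : MemLp f p (volume.restrict (Set.Ioc a b)) := by
  obtain ⟨C, hC⟩ := isCompact_Icc.exists_bound_of_continuousOn hf
  refine MemLp.of_bound ((hf.mono Set.Ioc_subset_Icc_self).aestronglyMeasurable
    measurableSet_Ioc) C ?_
  filter_upwards [ae_restrict_mem measurableSet_Ioc] with x hx
  exact hC x (Set.Ioc_subset_Icc_self hx)

/-- **Wirtinger's inequality** for complex-valued functions of zero mean with equal boundary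
values. -/
theorem integral_norm_sq_le_of_integral_eq_zero {a b : ℝ} (hab : a < b) {f f' : ℝ → ℂ}
    (hf : ContinuousOn f (Set.Icc a b))
    (hff' : ∀ x ∈ Set.Ioo a b, HasDerivAt f (f' x) x)
    (hf' : MemLp f' 2 (volume.restrict (Set.Ioc a b)))
    (hfab : f a = f b) (hmean : ∫ x in a..b, f x = 0) :
    ∫ x in a..b, ‖f x‖ ^ 2 ≤
      (b - a) ^ 2 / (4 * Real.pi ^ 2) * ∫ x in a..b, ‖f' x‖ ^ 2 := by
  have hba : 0 < b - a := sub_pos.mpr hab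
  have hf2 : MemLp f 2 (volume.restrict (Set.Ioc a b)) :=
    memLp_restrict_Ioc_of_continuousOn_Icc 2 hf
  have hf'int : IntervalIntegrable f' volume a b :=
    (intervalIntegrable_iff_integrableOn_Ioc_of_le hab.le).mpr (hf'.integrable (by norm_num))
  have hcoeff (n : ℤ) : ‖fourierCoeffOn hab f n‖ ^ 2 ≤
      (b - a) ^ 2 / (4 * Real.pi ^ 2) * ‖fourierCoeffOn hab f' n‖ ^ 2 := by
    rcases eq_or_ne n 0 with rfl | hn
    · have h0 : fourierCoeffOn hab f 0 = 0 := by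
        simp [fourierCoeffOn_eq_integral, hmean]
      rw [h0, norm_zero, zero_pow two_ne_zero]
      positivity
    · have h := fourierCoeffOn_of_hasDerivAt_Ioo hab hn (by rwa [Set.uIcc_of_le hab.le])
        (by simpa only [min_eq_left hab.le, max_eq_right hab.le] using hff') hf'int
      have hnorm : ‖(b : ℂ) - a‖ = b - a := by
        rw [← Complex.ofReal_sub, Complex.norm_real, Real.norm_of_nonneg hba.le]
      have hn1 : (1 : ℝ) ≤ (n : ℝ) ^ 2 := by
        exact_mod_cast (one_le_sq_iff_one_le_abs n).mpr (Int.one_le_abs hn)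
      rw [h, hfab, sub_self, mul_zero, zero_sub]
      simp only [norm_mul, norm_neg, norm_div, norm_one, hnorm, Complex.norm_I, Complex.norm_real,
        Complex.norm_intCast, Complex.norm_ofNat, Real.norm_of_nonneg Real.pi_pos.le, mul_pow,
        div_pow, sq_abs, one_pow, mul_one]
      rw [← mul_assoc]
      gcongr
      rw [one_div_mul_eq_div]
      refine div_le_div_of_nonneg_left (by positivity) (by positivity) ?_
      nlinarith [mul_le_mul_of_nonneg_left hn1 (sq_nonneg Real.pi)]
  have h := hasSum_le hcoeff (hasSum_sq_fourierCoeffOn hab hf2)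
    ((hasSum_sq_fourierCoeffOn hab hf').mul_left _)
  rw [smul_eq_mul, smul_eq_mul, mul_left_comm] at h
  exact le_of_mul_le_mul_left h (inv_pos.mpr hba)

/-- Single-element Hermite interpolation error estimate: if `w` is twice continuously
differentiable on `[a, b]` and satisfies the clamped conditions
`w(a) = w(b) = 0`, `w'(a) = w'(b) = 0`, then
`∫ (w')² ≤ ((b - a)² / (4π²)) ∫ (w'')²`. -/
theorem clamped_wirtinger_inequality
    (a b : ℝ) (hab : a < b) (w w' w'' : ℝ → ℝ)
    (hw : ∀ x ∈ Set.Icc a b, HasDerivWithinAt w (w' x) (Set.Icc a b) x)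
    (hw' : ∀ x ∈ Set.Icc a b, HasDerivWithinAt w' (w'' x) (Set.Icc a b) x)
    (hw'' : ContinuousOn w'' (Set.Icc a b))
    (hwa : w a = 0) (hwb : w b = 0) (hw'a : w' a = 0) (hw'b : w' b = 0) :
    (∫ x in a..b, (w' x) ^ 2) ≤
      (b - a) ^ 2 / (4 * Real.pi ^ 2) * ∫ x in a..b, (w'' x) ^ 2 := by
  have hderiv : ∀ x ∈ Set.Ioo a b, HasDerivAt w (w' x) x := fun x hx ↦
    (hw x (Set.Ioo_subset_Icc_self hx)).hasDerivAt (Icc_mem_nhds hx.1 hx.2)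
  have hderiv' : ∀ x ∈ Set.Ioo a b, HasDerivAt w' (w'' x) x := fun x hx ↦
    (hw' x (Set.Ioo_subset_Icc_self hx)).hasDerivAt (Icc_mem_nhds hx.1 hx.2)
  have hw'c : ContinuousOn w' (Set.Icc a b) := fun x hx ↦ (hw' x hx).continuousWithinAt
  have hmean : ∫ x in a..b, w' x = 0 := by
    rw [integral_eq_sub_of_hasDerivAt_of_le hab.le (fun x hx ↦ (hw x hx).continuousWithinAt) hderiv
      (hw'c.intervalIntegrable_of_Icc hab.le), hwa, hwb, sub_self]
  have h := integral_norm_sq_le_of_integral_eq_zero hab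
    (f := fun x ↦ (w' x : ℂ)) (f' := fun x ↦ (w'' x : ℂ))
    (Complex.continuous_ofReal.comp_continuousOn hw'c)
    (fun x hx ↦ (hderiv' x hx).ofReal_comp)
    (memLp_restrict_Ioc_of_continuousOn_Icc 2 (Complex.continuous_ofReal.comp_continuousOn hw''))
    (by rw [hw'a, hw'b]) (by rw [intervalIntegral.integral_ofReal, hmean, Complex.ofReal_zero])
  simpa only [Complex.norm_real, Real.norm_eq_abs, sq_abs] using h
end

section
/- Let 0 = x_1 < x_2 < ⋯ < x_{N+1} = L be a partition of [0, L] with element lengths h_k = x_{k+1} − x_k, and let κ_1, …, κ_N be positive reals. Let EI : ℝ → ℝ be integrable on [0, L] and satisfy EI(x) ≥ κ_k for all x ∈ [x_k, x_{k+1}] and all k = 1, …, N. Define h_{EI}² = max_{k=1,…,N} (h_k² / κ_k). If w : ℝ → ℝ is twice continuously differentiable on [0, L] with w(x_k) = 0 and w'(x_k) = 0 at every node x_k, k = 1, …, N+1, then ∫_0^L (w'(x))² dx ≤ (h_{EI}²/(4π²)) · ∫_0^L EI(x) (w''(x))² dx. -/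
open MeasureTheory intervalIntegral

/-- Wirtinger's inequality for periodic functions with zero mean. -/
theorem integral_norm_sq_le_of_periodic_of_integral_eq_zero {a b : ℝ} (hab : a < b) {f f' : ℝ → ℂ}
    (hf : ContinuousOn f (Set.Icc a b)) (hff' : ∀ t ∈ Set.Ioo a b, HasDerivAt f (f' t) t)
    (hf' : ContinuousOn f' (Set.Icc a b)) (hper : f a = f b) (hmean : ∫ t in a..b, f t = 0) :
    ∫ t in a..b, ‖f t‖ ^ 2 ≤ (b - a) ^ 2 / (4 * Real.pi ^ 2) * ∫ t in a..b, ‖f' t‖ ^ 2 := by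
  have hL2 : ∀ {g : ℝ → ℂ}, ContinuousOn g (Set.Icc a b) →
      MemLp g 2 (volume.restrict (Set.Ioc a b)) := fun hg ↦
    ((memLp_two_iff_integrable_sq_norm (hg.aestronglyMeasurable measurableSet_Icc)).2
      (hg.norm.pow 2).integrableOn_Icc).mono_measure
        (Measure.restrict_mono Set.Ioc_subset_Icc_self le_rfl)
  have hba : 0 < b - a := sub_pos.mpr hab
  have hsum := hasSum_sq_fourierCoeffOn hab (hL2 hf)
  have hsum' := (hasSum_sq_fourierCoeffOn hab (hL2 hf')).mul_left
    ((b - a) ^ 2 / (4 * Real.pi ^ 2))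
  have hcoeff : ∀ n : ℤ, ‖fourierCoeffOn hab f n‖ ^ 2 ≤
      (b - a) ^ 2 / (4 * Real.pi ^ 2) * ‖fourierCoeffOn hab f' n‖ ^ 2 := by
    intro n
    rcases eq_or_ne n 0 with rfl | hn
    · have h0 : fourierCoeffOn hab f 0 = 0 := by
        simp [fourierCoeffOn_eq_integral, hmean]
      rw [h0, norm_zero, zero_pow two_ne_zero]
      positivity
    · have hn1 : (1 : ℝ) ≤ (n : ℝ) ^ 2 := by
        exact_mod_cast (sq_pos_of_ne_zero hn : 0 < n ^ 2)
      have hba_norm : ‖(b : ℂ) - a‖ = b - a := by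
        rw [← Complex.ofReal_sub, Complex.norm_real, Real.norm_of_nonneg hba.le]
      rw [fourierCoeffOn_of_hasDerivAt_Ioo hab hn (by rwa [Set.uIcc_of_le hab.le])
        (by rwa [min_eq_left hab.le, max_eq_right hab.le])
        (hf'.intervalIntegrable_of_Icc hab.le), hper, sub_self, mul_zero, zero_sub]
      simp only [norm_mul, norm_neg, norm_div, norm_one, Complex.norm_I, Complex.norm_ofNat,
        Complex.norm_real, Complex.norm_intCast, hba_norm, Real.norm_of_nonneg Real.pi_pos.le,
        mul_one]
      have hrw : (1 / (2 * Real.pi * |(n : ℝ)|) * ((b - a) * ‖fourierCoeffOn hab f' n‖)) ^ 2 =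
          (b - a) ^ 2 / (4 * Real.pi ^ 2) * ‖fourierCoeffOn hab f' n‖ ^ 2 / (n : ℝ) ^ 2 := by
        rw [← sq_abs (n : ℝ)]
        have : |(n : ℝ)| ≠ 0 := by simpa using hn
        field_simp
        ring
      rw [hrw]
      exact div_le_self (by positivity) hn1
  have hle := hasSum_le hcoeff hsum hsum'
  simp only [smul_eq_mul] at hle
  rw [mul_left_comm] at hle
  exact le_of_mul_le_mul_left hle (inv_pos.mpr hba)

theorem sum_integral_castSucc_succ {E : Type*} [NormedAddCommGroup E] [NormedSpace ℝ E]
    {f : ℝ → E} {μ : Measure ℝ} {n : ℕ} (x : Fin (n + 1) → ℝ)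
    (hf : ∀ i j, IntervalIntegrable f μ (x i) (x j)) :
    ∑ k : Fin n, ∫ t in x k.castSucc..x k.succ, f t ∂μ = ∫ t in x 0..x (Fin.last n), f t ∂μ := by
  induction n with
  | zero => simp
  | succ n ih =>
    have h := ih (fun i ↦ x i.castSucc) fun i j ↦ hf _ _
    rw [Fin.sum_univ_castSucc]
    simp only [Fin.succ_castSucc, Fin.castSucc_zero, Fin.succ_last] at h ⊢
    rw [h]
    exact integral_add_adjacent_intervals (hf _ _) (hf _ _)

/-- Weighted estimate for the derivative `v` of a function with equal values at both endpoints. -/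
theorem integral_deriv_sq_le_weighted {a b c : ℝ} (hab : a < b) (hc : 0 < c)
    {ρ u v v' : ℝ → ℝ} (hρ : ∀ t ∈ Set.Icc a b, c ≤ ρ t)
    (hint : IntervalIntegrable (fun t ↦ ρ t * v' t ^ 2) volume a b)
    (hu : ∀ t ∈ Set.Icc a b, HasDerivWithinAt u (v t) (Set.Icc a b) t)
    (hv : ∀ t ∈ Set.Icc a b, HasDerivWithinAt v (v' t) (Set.Icc a b) t)
    (hv' : ContinuousOn v' (Set.Icc a b)) (hu_eq : u a = u b) (hv_eq : v a = v b) :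
    ∫ t in a..b, v t ^ 2 ≤
      (b - a) ^ 2 / c / (4 * Real.pi ^ 2) * ∫ t in a..b, ρ t * v' t ^ 2 := by
  have hvc : ContinuousOn v (Set.Icc a b) := fun t ht ↦ (hv t ht).continuousWithinAt
  have hmean : ∫ t in a..b, v t = 0 := by
    rw [integral_eq_sub_of_hasDerivAt_of_le hab.le (fun t ht ↦ (hu t ht).continuousWithinAt)
      (fun t ht ↦ (hu t (Set.Ioo_subset_Icc_self ht)).hasDerivAt (Icc_mem_nhds ht.1 ht.2))
      (hvc.intervalIntegrable_of_Icc hab.le), hu_eq, sub_self]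
  have hW := integral_norm_sq_le_of_periodic_of_integral_eq_zero hab
    (f := fun t ↦ (v t : ℂ)) (f' := fun t ↦ (v' t : ℂ))
    (Complex.continuous_ofReal.comp_continuousOn hvc)
    (fun t ht ↦ ((hv t (Set.Ioo_subset_Icc_self ht)).hasDerivAt
      (Icc_mem_nhds ht.1 ht.2)).ofReal_comp)
    (Complex.continuous_ofReal.comp_continuousOn hv') (by rw [hv_eq])
    (by rw [intervalIntegral.integral_ofReal, hmean, Complex.ofReal_zero])
  simp only [Complex.norm_real, Real.norm_eq_abs, sq_abs] at hW
  have hweight : c * ∫ t in a..b, v' t ^ 2 ≤ ∫ t in a..b, ρ t * v' t ^ 2 := by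
    rw [← intervalIntegral.integral_const_mul]
    exact integral_mono_on hab.le
      (((hv'.pow 2).const_mul c).intervalIntegrable_of_Icc hab.le) hint
      fun t ht ↦ mul_le_mul_of_nonneg_right (hρ t ht) (sq_nonneg _)
  calc ∫ t in a..b, v t ^ 2 ≤ (b - a) ^ 2 / (4 * Real.pi ^ 2) * ∫ t in a..b, v' t ^ 2 := hW
    _ = (b - a) ^ 2 / c / (4 * Real.pi ^ 2) * (c * ∫ t in a..b, v' t ^ 2) := by field_simp
    _ ≤ _ := mul_le_mul_of_nonneg_left hweight (by positivity)

/-- Lemma 3.4 of the paper (interpolation error estimate `‖w‖_b ≤ (h_EI/(2π)) ‖w‖_a`):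
for a partition `0 = x 0 < x 1 < ⋯ < x N = L` of `[0, L]` with elementwise lower bounds
`κ k ≤ EI` on each element, any `w` that is twice continuously differentiable on `[0, L]`
and vanishes together with its first derivative at all nodes satisfies
`∫ (w')² ≤ (h_EI²/(4π²)) ∫ EI (w'')²`, where `h_EI² = max_k hₖ²/κ k`. -/
theorem interpolation_error_estimate
    (N : ℕ) (hN : 0 < N) (L : ℝ) (hL : 0 < L)
    (x : Fin (N + 1) → ℝ)
    (hx0 : x ⟨0, Nat.succ_pos N⟩ = 0) (hxN : x (Fin.last N) = L)
    (hmono : ∀ k : Fin N, x k.castSucc < x k.succ)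
    (κ : Fin N → ℝ) (hκ : ∀ k, 0 < κ k)
    (EI : ℝ → ℝ) (hEI_int : IntegrableOn EI (Set.Icc 0 L))
    (hEI_low : ∀ k : Fin N, ∀ y ∈ Set.Icc (x k.castSucc) (x k.succ), κ k ≤ EI y)
    (w w' w'' : ℝ → ℝ)
    (hw : ∀ t ∈ Set.Icc (0 : ℝ) L, HasDerivWithinAt w (w' t) (Set.Icc 0 L) t)
    (hw' : ∀ t ∈ Set.Icc (0 : ℝ) L, HasDerivWithinAt w' (w'' t) (Set.Icc 0 L) t)
    (hw'' : ContinuousOn w'' (Set.Icc 0 L))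
    (hnode : ∀ k : Fin (N + 1), w (x k) = 0 ∧ w' (x k) = 0) :
    (∫ t in (0 : ℝ)..L, (w' t) ^ 2) ≤
      (Finset.univ.sup' (Finset.univ_nonempty_iff.mpr ⟨⟨0, hN⟩⟩)
          fun k : Fin N => (x k.succ - x k.castSucc) ^ 2 / κ k) / (4 * Real.pi ^ 2) *
        ∫ t in (0 : ℝ)..L, EI t * (w'' t) ^ 2 := by
  have hx_mono : StrictMono x := Fin.strictMono_iff_lt_succ.mpr hmono
  have hx_mem : ∀ i, x i ∈ Set.Icc 0 L := fun i ↦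
    ⟨hx0 ▸ hx_mono.monotone (Fin.zero_le i), hxN ▸ hx_mono.monotone (Fin.le_last i)⟩
  have hsub : ∀ i j, Set.Icc (x i) (x j) ⊆ Set.Icc 0 L := fun i j ↦
    Set.Icc_subset_Icc (hx_mem i).1 (hx_mem j).2
  have hintegrable : ∀ {g : ℝ → ℝ}, IntegrableOn g (Set.Icc 0 L) →
      ∀ i j, IntervalIntegrable g volume (x i) (x j) := fun hg i j ↦
    (hg.mono_set (Set.uIcc_subset_Icc (hx_mem i) (hx_mem j))).intervalIntegrable
  have hI' := hintegrable
    (ContinuousOn.integrableOn_Icc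
      (ContinuousOn.pow (fun t ht ↦ (hw' t ht).continuousWithinAt) 2) : IntegrableOn
        (fun t ↦ w' t ^ 2) (Set.Icc 0 L))
  have hI'' : ∀ i j, IntervalIntegrable (fun t ↦ EI t * w'' t ^ 2) volume (x i) (x j) :=
    hintegrable (hEI_int.mul_continuousOn (hw''.pow 2) isCompact_Icc)
  have h0 : x 0 = 0 := hx0
  have hsum' := sum_integral_castSucc_succ x hI'
  have hsum'' := sum_integral_castSucc_succ x hI''
  rw [h0, hxN] at hsum' hsum''
  rw [← hsum', ← hsum'', Finset.mul_sum]
  refine Finset.sum_le_sum fun k _ ↦ ?_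
  have hk := hsub k.castSucc k.succ
  refine (integral_deriv_sq_le_weighted (hmono k) (hκ k) (hEI_low k) (hI'' _ _)
    (fun t ht ↦ (hw t (hk ht)).mono hk) (fun t ht ↦ (hw' t (hk ht)).mono hk) (hw''.mono hk)
    (by rw [(hnode _).1, (hnode _).1]) (by rw [(hnode _).2, (hnode _).2])).trans ?_
  refine mul_le_mul_of_nonneg_right (div_le_div_of_nonneg_right
    (Finset.le_sup' (fun k : Fin N ↦ (x k.succ - x k.castSucc) ^ 2 / κ k) (Finset.mem_univ k))
    (by positivity)) ?_
  exact integral_nonneg (hmono k).le fun t ht ↦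
    mul_nonneg ((hκ k).le.trans (hEI_low k t ht)) (sq_nonneg _)
end

section
/- Let 0 = x_1 < x_2 < ⋯ < x_{N+1} = L be a partition of [0, L], let κ_1, …, κ_N be positive reals, and for each k = 1, …, N let p_k : ℝ → ℝ be a polynomial function of degree at most 3. Let w : ℝ → ℝ be twice continuously differentiable on [0, L] with w(x_k) = 0 and w'(x_k) = 0 at every node x_k, k = 1, …, N+1. Then ∑_{k=1}^N κ_k ∫_{x_k}^{x_{k+1}} w''(x) · p_k''(x) dx = 0. -/
open MeasureTheory intervalIntegral

/-- On one element, the second derivative of a function that vanishes together with its derivative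
at both endpoints integrates to zero against every polynomial of degree at most one. -/
theorem integral_second_deriv_mul_affine_eq_zero {a b : ℝ} (hab : a ≤ b) {w w' w'' : ℝ → ℝ}
    (hw : ∀ t ∈ Set.Icc a b, HasDerivWithinAt w (w' t) (Set.Icc a b) t)
    (hw' : ∀ t ∈ Set.Icc a b, HasDerivWithinAt w' (w'' t) (Set.Icc a b) t)
    (hw'' : ContinuousOn w'' (Set.Icc a b))
    (ha : w a = 0) (ha' : w' a = 0) (hb : w b = 0) (hb' : w' b = 0)
    {q : Polynomial ℝ} (hq : q.derivative.derivative = 0) :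
    ∫ t in a..b, w'' t * q.eval t = 0 := by
  have hF : ∀ t ∈ Set.Icc a b,
      HasDerivWithinAt (fun s => w' s * q.eval s - w s * q.derivative.eval s)
        (w'' t * q.eval t) (Set.Icc a b) t := fun t ht => by
    have h := ((hw' t ht).mul (q.hasDerivAt t).hasDerivWithinAt).sub
      ((hw t ht).mul (q.derivative.hasDerivAt t).hasDerivWithinAt)
    refine h.congr_deriv ?_
    simp [hq]
  rw [integral_eq_sub_of_hasDerivAt_of_le hab (fun t ht => (hF t ht).continuousWithinAt)
    (fun t ht => (hF t (Set.Ioo_subset_Icc_self ht)).hasDerivAt (Icc_mem_nhds ht.1 ht.2))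
    ((hw''.mul q.continuousOn).intervalIntegrable_of_Icc hab)]
  simp [ha, ha', hb, hb']

/-- Lemma 4.1 of the paper: for a partition `0 = x 0 < x 1 < ⋯ < x N = L` of `[0, L]`,
positive piecewise constant stiffness values `κ k`, and cubic polynomial pieces `p k`,
the Hermite interpolation error `w` (vanishing together with its derivative at all nodes)
is `a`-orthogonal to the piecewise cubic finite element function:
`∑ₖ κₖ ∫_{xₖ}^{xₖ₊₁} w'' pₖ'' = 0`. -/
theorem pw_constant_orthogonality
    (N : ℕ) (hN : 0 < N) (L : ℝ) (hL : 0 < L)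
    (x : Fin (N + 1) → ℝ)
    (hx0 : x ⟨0, Nat.succ_pos N⟩ = 0) (hxN : x (Fin.last N) = L)
    (hmono : ∀ k : Fin N, x k.castSucc < x k.succ)
    (κ : Fin N → ℝ) (hκ : ∀ k, 0 < κ k)
    (p : Fin N → Polynomial ℝ) (hp : ∀ k, (p k).degree ≤ 3)
    (w w' w'' : ℝ → ℝ)
    (hw : ∀ t ∈ Set.Icc (0 : ℝ) L, HasDerivWithinAt w (w' t) (Set.Icc 0 L) t)
    (hw' : ∀ t ∈ Set.Icc (0 : ℝ) L, HasDerivWithinAt w' (w'' t) (Set.Icc 0 L) t)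
    (hw'' : ContinuousOn w'' (Set.Icc 0 L))
    (hnode : ∀ k : Fin (N + 1), w (x k) = 0 ∧ w' (x k) = 0) :
    (∑ k : Fin N, κ k *
      ∫ t in (x k.castSucc)..(x k.succ),
        w'' t * ((p k).derivative.derivative).eval t) = 0 := by
  have hx : Monotone x := (Fin.strictMono_iff_lt_succ.2 hmono).monotone
  refine Finset.sum_eq_zero fun k _ => ?_
  have hsub : Set.Icc (x k.castSucc) (x k.succ) ⊆ Set.Icc 0 L :=
    Set.Icc_subset_Icc (hx0 ▸ hx (Fin.zero_le _)) (hxN ▸ hx (Fin.le_last _))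
  have hq : (p k).derivative.derivative.derivative.derivative = 0 :=
    Polynomial.iterate_derivative_eq_zero (x := 4)
      ((Polynomial.natDegree_le_of_degree_le (hp k)).trans_lt (by norm_num))
  rw [integral_second_deriv_mul_affine_eq_zero (hmono k).le
    (fun t ht => (hw t (hsub ht)).mono hsub) (fun t ht => (hw' t (hsub ht)).mono hsub)
    (hw''.mono hsub) (hnode _).1 (hnode _).2 (hnode _).1 (hnode _).2 hq, mul_zero]
end

section
/- Let V be a real vector space and let a, b : V × V → ℝ be symmetric bilinear forms with a positive semidefinite (a(v,v) ≥ 0 for all v) and b positive definite (b(v,v) > 0 for all v ≠ 0). Write ‖v‖_a = √(a(v,v)) and ‖v‖_b = √(b(v,v)). Let W ⊆ V be a subspace, let Π : V → W be a linear map satisfying a(u − Πu, w) = 0 for all u ∈ V and w ∈ W, and let C ≥ 0 be a constant such that ‖u − Πu‖_b ≤ C ‖u − Πu‖_a for all u ∈ V. Suppose u₀ ∈ V, u₀ ≠ 0, and λ ≥ 0 satisfy a(u₀, v) = λ b(u₀, v) for all v ∈ V. Let λ_h be a real number with λ_h ≤ a(w,w)/b(w,w) for every nonzero w ∈ W (for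 instance λ_h = inf_{w ∈ W, w≠0} a(w,w)/b(w,w)), and assume λ_h ≥ 0. Then λ_h / (1 + λ_h C²) ≤ λ. -/
/-- Liu's lower eigenvalue bound (Theorem 3.1 of the paper, first-eigenvalue case):
if `Π` is the `a`-orthogonal projector onto the subspace `W`, `C` the projection-error
constant relating the `b`- and `a`-norms, `(λ, u₀)` an exact eigenpair, and `λ_h` a
lower bound of the Rayleigh quotient on `W ∖ {0}`, then `λ_h / (1 + λ_h C²) ≤ λ`. -/
theorem liu_lower_bound_first
    {V : Type*} [AddCommGroup V] [Module ℝ V]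
    (a b : V →ₗ[ℝ] V →ₗ[ℝ] ℝ)
    (ha_symm : ∀ u v : V, a u v = a v u)
    (hb_symm : ∀ u v : V, b u v = b v u)
    (ha_pos : ∀ v : V, 0 ≤ a v v)
    (hb_pos : ∀ v : V, v ≠ 0 → 0 < b v v)
    (W : Submodule ℝ V) (proj : V →ₗ[ℝ] V) (hproj : ∀ u : V, proj u ∈ W)
    (hortho : ∀ u : V, ∀ w ∈ W, a (u - proj u) w = 0)
    (C : ℝ) (hC : 0 ≤ C)
    (hest : ∀ u : V,
      Real.sqrt (b (u - proj u) (u - proj u)) ≤ C * Real.sqrt (a (u - proj u) (u - proj u)))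
    (u₀ : V) (hu₀ : u₀ ≠ 0) (lam : ℝ) (hlam : 0 ≤ lam)
    (heig : ∀ v : V, a u₀ v = lam * b u₀ v)
    (lamh : ℝ) (hlamh0 : 0 ≤ lamh)
    (hlamh : ∀ w ∈ W, w ≠ 0 → lamh ≤ a w w / b w w) :
    lamh / (1 + lamh * C ^ 2) ≤ lam := by
  obtain ⟨p, hp⟩ : ∃ p, p = proj u₀ := ⟨_, rfl⟩
  obtain ⟨e, he⟩ : ∃ e, e = u₀ - proj u₀ := ⟨_, rfl⟩
  have hpW : p ∈ W := hp ▸ hproj u₀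
  have hu : u₀ = p + e := by rw [hp, he]; abel
  have hb_nonneg : ∀ v, 0 ≤ b v v := fun v => by
    rcases eq_or_ne v 0 with rfl | hv
    · simp
    · exact (hb_pos v hv).le
  have hep : a e p = 0 := he ▸ hortho u₀ p hpW
  have hA : a u₀ u₀ = a p p + a e e := by
    rw [hu]
    simp only [map_add, LinearMap.add_apply, ha_symm p e, hep]
    ring
  have hB : b u₀ u₀ = b p p + 2 * b p e + b e e := by
    rw [hu]
    simp only [map_add, LinearMap.add_apply, hb_symm e p]
    ring
  have hbe : b e e ≤ C ^ 2 * a e e := by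
    have h := pow_le_pow_left₀ (Real.sqrt_nonneg _) (hest u₀) 2
    rwa [← he, mul_pow, Real.sq_sqrt (hb_nonneg e), Real.sq_sqrt (ha_pos e)] at h
  have hbp : lamh * b p p ≤ a p p := by
    rcases eq_or_ne p 0 with h | h
    · simp [h]
    · exact (le_div_iff₀ (hb_pos p h)).mp (hlamh p hpW h)
  have hcross : 2 * lamh * b p e ≤ lamh * C ^ 2 * a p p + a e e - lamh * b e e
      + lamh * C ^ 2 * a e e := by
    rcases hC.eq_or_lt with rfl | hC
    · have he0 : e = 0 := by
        by_contra h
        have := hb_pos e h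
        linarith
      simp [he0]
    · have hC2 : 0 < C ^ 2 := by positivity
      have hsq := hb_nonneg ((lamh * C ^ 2) • p - e)
      simp only [map_sub, map_smul, LinearMap.sub_apply, LinearMap.smul_apply, smul_eq_mul,
        hb_symm e p] at hsq
      have h₁ : lamh * C ^ 4 * (lamh * b p p) ≤ lamh * C ^ 4 * a p p := by gcongr
      have h₂ : lamh * b e e ≤ lamh * (C ^ 2 * a e e) := by gcongr
      have h₃ : C ^ 2 * (2 * lamh * b p e) ≤ C ^ 2 * (lamh * C ^ 2 * a p p + a e e) := by
        linarith
      have := le_of_mul_le_mul_left h₃ hC2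
      linarith
  have hbu := hb_pos u₀ hu₀
  have hden : 0 < 1 + lamh * C ^ 2 := by positivity
  rw [div_le_iff₀ hden]
  refine le_of_mul_le_mul_right ?_ hbu
  have hAB := heig u₀
  calc lamh * b u₀ u₀ ≤ (1 + lamh * C ^ 2) * a u₀ u₀ := by
        rw [hB, hA]
        linarith
    _ = lam * (1 + lamh * C ^ 2) * b u₀ u₀ := by
        rw [hAB]
        ring
end

section
/- Let V be a real vector space and let a, b : V × V → ℝ be symmetric bilinear forms with a positive semidefinite and b positive definite. Write ‖v‖_a = √(a(v,v)) and ‖v‖_b = √(b(v,v)). Let W ⊆ V be a finite-dimensional subspace with dim W ≥ i, let Π : V → W be linear with a(u − Πu, w) = 0 for all u ∈ V, w ∈ W, and let C ≥ 0 satisfy ‖u − Πu‖_b ≤ C ‖u − Πu‖_a for all u ∈ V. Suppose u₁, …, u_i ∈ V are b-orthonormal (b(u_j, u_l) = δ_{jl}) and there are reals 0 ≤ λ₁ ≤ λ₂ ≤ ⋯ ≤ λ_i such that a(u_j, v) = λ_j b(u_j, v) for all v ∈ V and all j = 1, …, i. Define the i-th discrete min–max value λ_{h,i} = inf over i-dimensional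 subspaces E of W of (sup over nonzero w ∈ E of a(w,w)/b(w,w)). Then λ_{h,i} / (1 + λ_{h,i} C²) ≤ λ_i. -/
/-- The `i`-th discrete min–max value: the infimum over `i`-dimensional subspaces `E` of
`W` of the supremum of the Rayleigh quotient `a(w,w)/b(w,w)` over nonzero `w ∈ E`
(Courant–Fischer–Weyl min–max principle on the finite element space `W`). -/
noncomputable def discreteMinMax {V : Type*} [AddCommGroup V] [Module ℝ V]
    (a b : V →ₗ[ℝ] V →ₗ[ℝ] ℝ) (W : Submodule ℝ V) (i : ℕ) : ℝ :=
  sInf {s : ℝ | ∃ E : Submodule ℝ V, E ≤ W ∧ Module.finrank ℝ E = i ∧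
    s = sSup {r : ℝ | ∃ w ∈ E, w ≠ 0 ∧ r = a w w / b w w}}

/-- On combinations of a `b`-orthonormal eigenfamily, the Rayleigh quotient is at most any upper
bound of the eigenvalues. -/
theorem rayleigh_le_of_orthonormal_eigenvectors {ι V : Type*} [Fintype ι] [DecidableEq ι]
    [AddCommGroup V] [Module ℝ V] (a b : V →ₗ[ℝ] V →ₗ[ℝ] ℝ) {u : ι → V}
    (hu : ∀ j l, b (u j) (u l) = if j = l then (1 : ℝ) else 0)
    {lam : ι → ℝ} (heig : ∀ j v, a (u j) v = lam j * b (u j) v)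
    {M : ℝ} (hM : ∀ j, lam j ≤ M) (c : ι → ℝ) :
    a (∑ j, c j • u j) (∑ j, c j • u j) ≤ M * b (∑ j, c j • u j) (∑ j, c j • u j) := by
  have hcoeff : ∀ j, b (u j) (∑ l, c l • u l) = c j := fun j => by simp [hu]
  have hleft : ∀ (f : V →ₗ[ℝ] V →ₗ[ℝ] ℝ) (v : V),
      f (∑ j, c j • u j) v = ∑ j, c j * f (u j) v := fun f v => by simp
  rw [hleft a, hleft b, Finset.mul_sum]
  refine Finset.sum_le_sum fun j _ => ?_
  rw [heig, hcoeff]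
  nlinarith [mul_nonneg (sub_nonneg.2 (hM j)) (sq_nonneg (c j))]

/-- A Rayleigh bound at `w + e` passes to `w` when `e` is `a`-orthogonal to `w` and the `b`-energy
of `e` is controlled by its `a`-energy. -/
theorem rayleigh_le_of_orthogonal_error {V : Type*} [AddCommGroup V] [Module ℝ V]
    (a b : V →ₗ[ℝ] V →ₗ[ℝ] ℝ)
    (ha_symm : ∀ u v, a u v = a v u) (hb_symm : ∀ u v, b u v = b v u)
    (ha_nonneg : ∀ v, 0 ≤ a v v) (hb_pos : ∀ v, v ≠ 0 → 0 < b v v)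
    {w e : V} (hew : a e w = 0) {c M : ℝ} (hc : 0 ≤ c) (hMc : M * c < 1)
    (he : b e e ≤ c * a e e) (hv : a (w + e) (w + e) ≤ M * b (w + e) (w + e)) :
    a w w ≤ M / (1 - M * c) * b w w := by
  have ht : 0 < 1 - M * c := by linarith
  rw [div_mul_eq_mul_div, le_div_iff₀ ht]
  simp only [map_add, LinearMap.add_apply, hew, ha_symm w e, hb_symm e w] at hv
  have hX := ha_nonneg e
  rcases hc.eq_or_lt with rfl | hc
  · have : e = 0 := by
      by_contra h
      linarith [hb_pos e h]
    subst this
    simp at hv ⊢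
    exact hv
  · have hsq : 0 ≤ b ((M * c) • w - (1 - M * c) • e) ((M * c) • w - (1 - M * c) • e) := by
      by_cases h : (M * c) • w - (1 - M * c) • e = 0
      · simp [h]
      · exact (hb_pos _ h).le
    simp only [map_sub, map_smul, LinearMap.sub_apply, LinearMap.smul_apply, smul_eq_mul,
      hb_symm e w] at hsq
    refine le_of_mul_le_mul_left ?_ hc
    have h1 := mul_le_mul_of_nonneg_left hv (mul_pos hc ht).le
    have h2 := mul_le_mul_of_nonneg_left he ht.le
    linarith

section DiscreteMinMax

variable {V : Type*} [AddCommGroup V] [Module ℝ V] {a b : V →ₗ[ℝ] V →ₗ[ℝ] ℝ}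

theorem sSup_rayleigh_nonneg (ha : ∀ v, 0 ≤ a v v) (hb : ∀ v, v ≠ 0 → 0 < b v v)
    (E : Submodule ℝ V) : 0 ≤ sSup {r : ℝ | ∃ w ∈ E, w ≠ 0 ∧ r = a w w / b w w} := by
  refine Real.sSup_nonneg ?_
  rintro r ⟨w, -, hw, rfl⟩
  exact div_nonneg (ha w) (hb w hw).le

theorem discreteMinMax_nonneg (ha : ∀ v, 0 ≤ a v v) (hb : ∀ v, v ≠ 0 → 0 < b v v)
    (W : Submodule ℝ V) (i : ℕ) : 0 ≤ discreteMinMax a b W i := by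
  refine Real.sInf_nonneg ?_
  rintro s ⟨E, -, -, rfl⟩
  exact sSup_rayleigh_nonneg ha hb E

theorem discreteMinMax_le (ha : ∀ v, 0 ≤ a v v) (hb : ∀ v, v ≠ 0 → 0 < b v v)
    {W E : Submodule ℝ V} (hE : E ≤ W) {M : ℝ} (hM : 0 ≤ M)
    (h : ∀ w ∈ E, a w w ≤ M * b w w) :
    discreteMinMax a b W (Module.finrank ℝ E) ≤ M := by
  unfold discreteMinMax
  refine le_trans (csInf_le ⟨0, ?_⟩ ⟨E, hE, rfl, rfl⟩) (Real.sSup_le ?_ hM)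
  · rintro s ⟨F, -, -, rfl⟩
    exact sSup_rayleigh_nonneg ha hb F
  · rintro r ⟨w, hw, hw0, rfl⟩
    exact (div_le_iff₀ (hb w hw0)).2 (h w hw)

end DiscreteMinMax

/-- Liu's lower eigenvalue bound (Theorem 3.1 of the paper) for the `i`-th eigenvalue
(`i = n + 1`): given a `b`-orthonormal family of exact eigenvectors `u 0, …, u n` with
nondecreasing nonnegative eigenvalues `lam 0 ≤ ⋯ ≤ lam n`, an `a`-orthogonal projector
onto `W` with projection-error constant `C`, and `dim W ≥ n + 1`, the `(n+1)`-st discrete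
min–max value `λ_h` satisfies `λ_h / (1 + λ_h C²) ≤ lam n`. -/
theorem liu_lower_bound_ith
    {V : Type*} [AddCommGroup V] [Module ℝ V]
    (a b : V →ₗ[ℝ] V →ₗ[ℝ] ℝ)
    (ha_symm : ∀ u v : V, a u v = a v u)
    (hb_symm : ∀ u v : V, b u v = b v u)
    (ha_pos : ∀ v : V, 0 ≤ a v v)
    (hb_pos : ∀ v : V, v ≠ 0 → 0 < b v v)
    (W : Submodule ℝ V) [FiniteDimensional ℝ W]
    (n : ℕ) (hdim : n + 1 ≤ Module.finrank ℝ W)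
    (proj : V →ₗ[ℝ] V) (hproj : ∀ u : V, proj u ∈ W)
    (hortho : ∀ u : V, ∀ w ∈ W, a (u - proj u) w = 0)
    (C : ℝ) (hC : 0 ≤ C)
    (hest : ∀ u : V,
      Real.sqrt (b (u - proj u) (u - proj u)) ≤ C * Real.sqrt (a (u - proj u) (u - proj u)))
    (u : Fin (n + 1) → V)
    (horthonorm : ∀ j l : Fin (n + 1), b (u j) (u l) = if j = l then (1 : ℝ) else 0)
    (lam : Fin (n + 1) → ℝ)
    (hlam0 : ∀ j, 0 ≤ lam j) (hlam_mono : Monotone lam)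
    (heig : ∀ j : Fin (n + 1), ∀ v : V, a (u j) v = lam j * b (u j) v) :
    discreteMinMax a b W (n + 1) / (1 + discreteMinMax a b W (n + 1) * C ^ 2) ≤
      lam (Fin.last n) := by
  set μ := discreteMinMax a b W (n + 1) with hμ
  set M := lam (Fin.last n) with hM
  have hμ0 : 0 ≤ μ := discreteMinMax_nonneg ha_pos hb_pos W _
  have hM0 : 0 ≤ M := hlam0 _
  rw [div_le_iff₀ (by positivity)]
  rcases le_or_gt 1 (M * C ^ 2) with hMC | hMC
  · nlinarith [mul_le_mul_of_nonneg_left hMC hμ0]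
  have ht : 0 < 1 - M * C ^ 2 := by linarith
  have herr : ∀ v, b (v - proj v) (v - proj v) ≤ C ^ 2 * a (v - proj v) (v - proj v) := fun v => by
    have h := Real.sqrt_le_iff.1 (hest v)
    rw [mul_pow, Real.sq_sqrt (ha_pos _)] at h
    exact h.2
  let T := Fintype.linearCombination ℝ u
  have hT : ∀ c, a (T c) (T c) ≤ M * b (T c) (T c) := fun c =>
    rayleigh_le_of_orthonormal_eigenvectors a b horthonorm heig
      (fun j => hlam_mono (Fin.le_last j)) c
  have hproj_rayleigh : ∀ c,
      a (proj (T c)) (proj (T c)) ≤ M / (1 - M * C ^ 2) * b (proj (T c)) (proj (T c)) := fun c =>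
    rayleigh_le_of_orthogonal_error a b ha_symm hb_symm ha_pos hb_pos
      (hortho (T c) _ (hproj _)) (sq_nonneg C) hMC (herr _)
      (by rw [add_sub_cancel]; exact hT c)
  have hinj : Function.Injective (proj ∘ₗ T) := by
    refine (injective_iff_map_eq_zero _).2 fun c hc => ?_
    have hTc : T c = 0 := by
      by_contra h
      have h1 := herr (T c)
      rw [show proj (T c) = 0 from hc, sub_zero] at h1
      nlinarith [hb_pos _ h, mul_le_mul_of_nonneg_left (hT c) (sq_nonneg C),
        mul_pos ht (hb_pos _ h)]
    ext j
    have h2 : b (u j) (T c) = c j := by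
      simp [T, Fintype.linearCombination_apply, horthonorm]
    rw [← h2, hTc, map_zero, Pi.zero_apply]
  have hfin : Module.finrank ℝ (LinearMap.range (proj ∘ₗ T)) = n + 1 := by
    simp [LinearMap.finrank_range_of_inj hinj]
  have hμM : μ ≤ M / (1 - M * C ^ 2) := by
    rw [hμ, ← hfin]
    refine discreteMinMax_le ha_pos hb_pos ?_ (by positivity) ?_
    · rintro _ ⟨c, rfl⟩
      exact hproj _
    · rintro _ ⟨c, rfl⟩
      exact hproj_rayleigh c
  rw [le_div_iff₀ ht] at hμM
  linarith
end

section
/- Let V be a real vector space and let a, b : V × V → ℝ be symmetric bilinear forms with a positive semidefinite and b positive definite. Write ‖v‖_a = √(a(v,v)) and ‖v‖_b = √(b(v,v)). Let W ⊆ V be a subspace, Π : V → W a linear map with a(u − Πu, w) = 0 for all u ∈ V, w ∈ W, and C ≥ 0 a constant with ‖u − Πu‖_b ≤ C ‖u − Πu‖_a for all u ∈ V. Suppose u₀ ∈ V, u₀ ≠ 0, and λ ≥ 0 satisfy a(u₀, v) = λ b(u₀, v) for all v ∈ V, and moreover λ ≤ a(u,u)/b(u,u) for every nonzero u ∈ V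 (λ is the smallest exact eigenvalue, attained by u₀). Assume W contains a nonzero element and let λ_h = inf over nonzero w ∈ W of a(w,w)/b(w,w). Then λ_h / (1 + λ_h C²) ≤ λ ≤ λ_h. -/
/-- The first discrete eigenvalue: the infimum of the Rayleigh quotient `a(w,w)/b(w,w)`
over nonzero elements `w` of the subspace `W`. -/
noncomputable def discreteFirstEigenvalue {V : Type*} [AddCommGroup V] [Module ℝ V]
    (a b : V →ₗ[ℝ] V →ₗ[ℝ] ℝ) (W : Submodule ℝ V) : ℝ :=
  sInf {r : ℝ | ∃ w ∈ W, w ≠ 0 ∧ r = a w w / b w w}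

/-- Every element of the subspace satisfies the Rayleigh quotient bound. -/
theorem discreteFirstEigenvalue_mul_le {V : Type*} [AddCommGroup V] [Module ℝ V]
    (a b : V →ₗ[ℝ] V →ₗ[ℝ] ℝ) (ha_pos : ∀ v : V, 0 ≤ a v v)
    (hb_pos : ∀ v : V, v ≠ 0 → 0 < b v v) (W : Submodule ℝ V) {w : V} (hw : w ∈ W) :
    discreteFirstEigenvalue a b W * b w w ≤ a w w := by
  rcases eq_or_ne w 0 with rfl | hw0
  · simp
  rw [← le_div_iff₀ (hb_pos w hw0)]
  refine csInf_le ⟨0, ?_⟩ ⟨w, hw, hw0, rfl⟩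
  rintro r ⟨v, -, hv0, rfl⟩
  exact div_nonneg (ha_pos v) (hb_pos v hv0).le

/-- Two-sided bound for the first eigenvalue (first-eigenvalue case of Theorem 4.3 of
the paper): if `Π` is the `a`-orthogonal projector onto `W` with projection-error
constant `C`, `(λ, u₀)` is an exact eigenpair with `λ` the smallest exact eigenvalue,
and `λ_h` is the first discrete eigenvalue on `W`, then
`λ_h / (1 + λ_h C²) ≤ λ ≤ λ_h`. -/
theorem two_sided_first_eigenvalue_bound
    {V : Type*} [AddCommGroup V] [Module ℝ V]
    (a b : V →ₗ[ℝ] V →ₗ[ℝ] ℝ)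
    (ha_symm : ∀ u v : V, a u v = a v u)
    (hb_symm : ∀ u v : V, b u v = b v u)
    (ha_pos : ∀ v : V, 0 ≤ a v v)
    (hb_pos : ∀ v : V, v ≠ 0 → 0 < b v v)
    (W : Submodule ℝ V) (proj : V →ₗ[ℝ] V) (hproj : ∀ u : V, proj u ∈ W)
    (hortho : ∀ u : V, ∀ w ∈ W, a (u - proj u) w = 0)
    (C : ℝ) (hC : 0 ≤ C)
    (hest : ∀ u : V,
      Real.sqrt (b (u - proj u) (u - proj u)) ≤ C * Real.sqrt (a (u - proj u) (u - proj u)))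
    (u₀ : V) (hu₀ : u₀ ≠ 0) (lam : ℝ) (hlam : 0 ≤ lam)
    (heig : ∀ v : V, a u₀ v = lam * b u₀ v)
    (hmin : ∀ u : V, u ≠ 0 → lam ≤ a u u / b u u)
    (hW : ∃ w ∈ W, w ≠ (0 : V)) :
    discreteFirstEigenvalue a b W / (1 + discreteFirstEigenvalue a b W * C ^ 2) ≤ lam ∧
      lam ≤ discreteFirstEigenvalue a b W := by
  set m := discreteFirstEigenvalue a b W
  have hb_nonneg : ∀ v, 0 ≤ b v v := fun v ↦ by
    rcases eq_or_ne v 0 with rfl | hv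
    · simp
    · exact (hb_pos v hv).le
  have hlow : lam ≤ m := by
    obtain ⟨w, hw, hw0⟩ := hW
    refine le_csInf ⟨_, w, hw, hw0, rfl⟩ ?_
    rintro r ⟨v, -, hv0, rfl⟩
    exact hmin v hv0
  have hm0 : 0 ≤ m := hlam.trans hlow
  refine ⟨?_, hlow⟩
  rw [div_le_iff₀ (by positivity)]
  obtain ⟨e, he⟩ : ∃ e, e = u₀ - proj u₀ := ⟨_, rfl⟩
  obtain ⟨p, hp⟩ : ∃ p, p = proj u₀ := ⟨_, rfl⟩
  have hu : u₀ = p + e := by rw [he, hp]; abel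
  have haep : a e p = 0 := by rw [he, hp]; exact hortho u₀ _ (hproj u₀)
  have hray : m * b p p ≤ a p p :=
    discreteFirstEigenvalue_mul_le a b ha_pos hb_pos W (hp ▸ hproj u₀)
  have herr : b e e ≤ C ^ 2 * a e e := by
    have h := pow_le_pow_left₀ (Real.sqrt_nonneg _) (hest u₀) 2
    rwa [← he, mul_pow, Real.sq_sqrt (hb_nonneg e), Real.sq_sqrt (ha_pos e)] at h
  have hcs : b p e ^ 2 ≤ b p p * b e e :=
    LinearMap.BilinForm.apply_sq_le_of_symm b hb_nonneg ⟨hb_symm⟩ p e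
  have hcross : 2 * (m * b p e) ≤ a e e + m * C ^ 2 * a p p := by
    have hae := ha_pos e
    have hap := ha_pos p
    refine (abs_le_of_sq_le_sq' ?_ (by positivity)).2
    have h : (m * b p p) * (m * b e e) ≤ a p p * (m * (C ^ 2 * a e e)) :=
      mul_le_mul hray (mul_le_mul_of_nonneg_left herr hm0)
        (mul_nonneg hm0 (hb_nonneg e)) hap
    nlinarith [sq_nonneg (a e e - m * C ^ 2 * a p p),
      mul_le_mul_of_nonneg_left hcs (sq_nonneg m)]
  have hbu : b u₀ u₀ = b p p + 2 * b p e + b e e := by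
    simp only [hu, map_add, LinearMap.add_apply, hb_symm e p]; ring
  have hau : lam * b u₀ u₀ = a p p + a e e := by
    rw [← heig u₀]
    simp only [hu, map_add, LinearMap.add_apply, ha_symm p e, haep]; ring
  refine le_of_mul_le_mul_right ?_ (hb_pos u₀ hu₀)
  calc m * b u₀ u₀ = m * b p p + 2 * (m * b p e) + m * b e e := by rw [hbu]; ring
    _ ≤ a p p + (a e e + m * C ^ 2 * a p p) + m * (C ^ 2 * a e e) := by gcongr
    _ = (1 + m * C ^ 2) * (lam * b u₀ u₀) := by rw [hau]; ring
    _ = lam * (1 + m * C ^ 2) * b u₀ u₀ := by ring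
end

section
/- Let 0 = x_1 < x_2 < ⋯ < x_{N+1} = L be a partition of [0, L] with element lengths h_k = x_{k+1} − x_k, and let t_1, …, t_N be positive reals (the elementwise thickness values). If w : ℝ → ℝ is twice continuously differentiable on [0, L] with w(x_k) = 0 and w'(x_k) = 0 at every node x_k, k = 1, …, N+1, then ∫_0^L (w'(x))² dx ≤ Ĉ² · ∑_{k=1}^N t_k³ ∫_{x_k}^{x_{k+1}} (w''(x))² dx, where Ĉ² = (1/(4π²)) · max_{k=1,…,N} (h_k²/t_k³). -/
open MeasureTheory intervalIntegral

theorem ContinuousOn.memLp_two_ofReal_Ioc {a b : ℝ} {f : ℝ → ℝ}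
    (hf : ContinuousOn f (Set.Icc a b)) :
    MemLp (fun t => (f t : ℂ)) 2 (volume.restrict (Set.Ioc a b)) := by
  obtain ⟨C, hC⟩ := isCompact_Icc.exists_bound_of_continuousOn hf
  have hfc : ContinuousOn (fun t => (f t : ℂ)) (Set.Ioc a b) :=
    Complex.continuous_ofReal.comp_continuousOn (hf.mono Set.Ioc_subset_Icc_self)
  refine MemLp.of_bound (hfc.aestronglyMeasurable measurableSet_Ioc) C ?_
  filter_upwards [ae_restrict_mem measurableSet_Ioc] with t ht
  simpa using hC t (Set.Ioc_subset_Icc_self ht)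

/-- **Wirtinger's inequality** for a function of mean zero with equal values at the endpoints. -/
theorem integral_sq_le_integral_deriv_sq_of_integral_eq_zero {a b : ℝ} (hab : a < b)
    {f f' : ℝ → ℝ} (hf : ContinuousOn f (Set.Icc a b))
    (hff' : ∀ t ∈ Set.Ioo a b, HasDerivAt f (f' t) t)
    (hf' : ContinuousOn f' (Set.Icc a b)) (hends : f a = f b)
    (hmean : ∫ t in a..b, f t = 0) :
    ∫ t in a..b, (f t) ^ 2 ≤ (b - a) ^ 2 / (4 * Real.pi ^ 2) * ∫ t in a..b, (f' t) ^ 2 := by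
  have hpos : 0 < b - a := sub_pos.2 hab
  have hS := hasSum_sq_fourierCoeffOn hab hf.memLp_two_ofReal_Ioc
  have hS' := (hasSum_sq_fourierCoeffOn hab hf'.memLp_two_ofReal_Ioc).mul_left
    ((b - a) ^ 2 / (4 * Real.pi ^ 2))
  have hle := hasSum_le (fun n => ?_) hS hS'
  · simp only [Complex.norm_real, Real.norm_eq_abs, sq_abs, smul_eq_mul] at hle
    rw [mul_left_comm] at hle
    exact le_of_mul_le_mul_left hle (inv_pos.2 hpos)
  · rcases eq_or_ne n 0 with rfl | hn
    · have h0 : fourierCoeffOn hab (fun t => (f t : ℂ)) 0 = 0 := by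
        rw [fourierCoeffOn_eq_integral]
        simp [intervalIntegral.integral_ofReal, hmean]
      rw [h0]
      rw [norm_zero, zero_pow two_ne_zero]
      positivity
    · have hc := fourierCoeffOn_of_hasDerivAt_Ioo hab (f := fun t => (f t : ℂ))
        (f' := fun t => (f' t : ℂ)) hn
        (by rw [Set.uIcc_of_le hab.le]; exact Complex.continuous_ofReal.comp_continuousOn hf)
        (by
          rw [min_eq_left hab.le, max_eq_right hab.le]
          exact fun t ht => (hff' t ht).ofReal_comp)
        (by
          apply ContinuousOn.intervalIntegrable
          rw [Set.uIcc_of_le hab.le]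
          exact Complex.continuous_ofReal.comp_continuousOn hf')
      have hn1 : (1 : ℝ) ≤ (n : ℝ) ^ 2 := by
        exact_mod_cast (sq_nonneg n).lt_of_ne' (pow_ne_zero 2 hn)
      have hnorm : ‖fourierCoeffOn hab (fun t => (f t : ℂ)) n‖ ^ 2 =
          (b - a) ^ 2 / (4 * Real.pi ^ 2 * (n : ℝ) ^ 2) *
            ‖fourierCoeffOn hab (fun t => (f' t : ℂ)) n‖ ^ 2 := by
        rw [hc, hends, sub_self, mul_zero, zero_sub, ← Complex.ofReal_sub]
        simp only [norm_mul, norm_neg, norm_div, norm_one, Complex.norm_real, Complex.norm_I,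
          Complex.norm_intCast, Complex.norm_ofNat, Real.norm_eq_abs, mul_pow, div_pow, sq_abs,
          one_pow, mul_one]
        ring
      rw [hnorm]
      refine mul_le_mul_of_nonneg_right ?_ (sq_nonneg _)
      exact div_le_div_of_nonneg_left (sq_nonneg _) (by positivity)
        (le_mul_of_one_le_right (by positivity) hn1)

/-- Additivity of the interval integral over a partition indexed by `Fin (N + 1)`. -/
theorem sum_integral_adjacent_intervals_fin {N : ℕ} (x : Fin (N + 1) → ℝ) {f : ℝ → ℝ}
    (hf : ∀ k : Fin N, IntervalIntegrable f volume (x k.castSucc) (x k.succ)) :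
    ∑ k : Fin N, ∫ t in (x k.castSucc)..(x k.succ), f t = ∫ t in (x 0)..(x (Fin.last N)), f t := by
  induction N with
  | zero => simp
  | succ N ih =>
    have hsub := ih (fun k => x k.castSucc) (fun k => by simpa using hf k.castSucc)
    have hint : IntervalIntegrable f volume (x 0) (x (Fin.last N).castSucc) := by
      have h : ∀ k : Fin (N + 1), IntervalIntegrable f volume (x 0) (x k.castSucc) := by
        intro k
        induction k using Fin.induction with
        | zero => simp
        | succ k hk => exact hk.trans (by simpa using hf k.castSucc)
      exact h _
    rw [Fin.sum_univ_castSucc]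
    simp only [Fin.succ_castSucc, Fin.castSucc_zero] at hsub ⊢
    rw [hsub, Fin.succ_last]
    exact integral_add_adjacent_intervals hint (by simpa using hf (Fin.last N))

/-- Stepped-beam interpolation error estimate (Corollary 6.1 of the paper): for a
partition `0 = x 0 < x 1 < ⋯ < x N = L` of `[0, L]` with positive elementwise thickness
values `th k`, any `w` that is twice continuously differentiable on `[0, L]` and
vanishes together with its first derivative at all nodes satisfies
`∫ (w')² ≤ Ĉ² ∑ₖ thₖ³ ∫_{xₖ}^{xₖ₊₁} (w'')²` with `Ĉ² = (1/(4π²)) maxₖ hₖ²/thₖ³`. -/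
theorem stepped_beam_interpolation_estimate
    (N : ℕ) (hN : 0 < N) (L : ℝ) (hL : 0 < L)
    (x : Fin (N + 1) → ℝ)
    (hx0 : x ⟨0, Nat.succ_pos N⟩ = 0) (hxN : x (Fin.last N) = L)
    (hmono : ∀ k : Fin N, x k.castSucc < x k.succ)
    (th : Fin N → ℝ) (hth : ∀ k, 0 < th k)
    (w w' w'' : ℝ → ℝ)
    (hw : ∀ t ∈ Set.Icc (0 : ℝ) L, HasDerivWithinAt w (w' t) (Set.Icc 0 L) t)
    (hw' : ∀ t ∈ Set.Icc (0 : ℝ) L, HasDerivWithinAt w' (w'' t) (Set.Icc 0 L) t)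
    (hw'' : ContinuousOn w'' (Set.Icc 0 L))
    (hnode : ∀ k : Fin (N + 1), w (x k) = 0 ∧ w' (x k) = 0) :
    (∫ t in (0 : ℝ)..L, (w' t) ^ 2) ≤
      (1 / (4 * Real.pi ^ 2) *
          Finset.univ.sup' (Finset.univ_nonempty_iff.mpr ⟨⟨0, hN⟩⟩)
            (fun k : Fin N => (x k.succ - x k.castSucc) ^ 2 / (th k) ^ 3)) *
        ∑ k : Fin N, (th k) ^ 3 *
          ∫ t in (x k.castSucc)..(x k.succ), (w'' t) ^ 2 := by
  have hx : StrictMono x := Fin.strictMono_iff_lt_succ.2 hmono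
  have hx0' : x 0 = 0 := hx0
  have hsub : ∀ k : Fin N, Set.Icc (x k.castSucc) (x k.succ) ⊆ Set.Icc 0 L := fun k =>
    Set.Icc_subset_Icc (hx0' ▸ hx.monotone (Fin.zero_le _)) (hxN ▸ hx.monotone (Fin.le_last _))
  have hderiv : ∀ {g g' : ℝ → ℝ}, (∀ t ∈ Set.Icc (0 : ℝ) L,
      HasDerivWithinAt g (g' t) (Set.Icc 0 L) t) → ∀ k : Fin N,
      ∀ t ∈ Set.Ioo (x k.castSucc) (x k.succ), HasDerivAt g (g' t) t := fun hg k t ht =>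
    (hg t (hsub k (Set.Ioo_subset_Icc_self ht))).hasDerivAt
      (Filter.mem_of_superset (Icc_mem_nhds ht.1 ht.2) (hsub k))
  have hwc : ContinuousOn w (Set.Icc 0 L) := fun t ht => (hw t ht).continuousWithinAt
  have hwc' : ContinuousOn w' (Set.Icc 0 L) := fun t ht => (hw' t ht).continuousWithinAt
  have hint : ∀ {g : ℝ → ℝ}, ContinuousOn g (Set.Icc 0 L) → ∀ k : Fin N,
      IntervalIntegrable g volume (x k.castSucc) (x k.succ) := fun hg k =>
    (hg.mono (hsub k)).intervalIntegrable_of_Icc (hmono k).le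
  rw [← hx0', ← hxN,
    ← sum_integral_adjacent_intervals_fin x (f := fun t => w' t ^ 2) (hint (hwc'.pow 2)), Finset.mul_sum]
  refine Finset.sum_le_sum fun k _ => ?_
  have hmean : ∫ t in (x k.castSucc)..(x k.succ), w' t = 0 := by
    rw [integral_eq_sub_of_hasDerivAt_of_le (hmono k).le (hwc.mono (hsub k)) (hderiv hw k)
      (hint hwc' k), (hnode _).1, (hnode _).1, sub_zero]
  have hW := integral_sq_le_integral_deriv_sq_of_integral_eq_zero (hmono k)
    (hwc'.mono (hsub k)) (hderiv hw' k) (hw''.mono (hsub k))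
    ((hnode _).2.trans (hnode _).2.symm) hmean
  have hmax := Finset.le_sup' (fun k : Fin N => (x k.succ - x k.castSucc) ^ 2 / (th k) ^ 3)
    (Finset.mem_univ k)
  have hthk : 0 < th k ^ 3 := pow_pos (hth k) 3
  have hnonneg : 0 ≤ ∫ t in (x k.castSucc)..(x k.succ), (w'' t) ^ 2 :=
    integral_nonneg (hmono k).le fun t _ => sq_nonneg _
  refine hW.trans ?_
  rw [← mul_assoc]
  refine mul_le_mul_of_nonneg_right ?_ hnonneg
  rw [div_eq_mul_one_div, mul_comm, mul_assoc]
  exact mul_le_mul_of_nonneg_left ((div_le_iff₀ hthk).1 hmax) (by positivity)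
end
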